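/- arXiv:1510.00282 — 2 statements merged into one kernel-verified Lean document; each statement's English description precedes it below -/
import Mathlib

section
/- Let b ≥ 2 be an integer and ξ an irrational real number with irrationality exponent μ. Then liminf_{n→∞} p(n, ξ, b)/n ≥ 1 + (1 − 2μ(μ−1)(μ−2)) / (μ³(μ−1)), where p(n, ξ, b) is the number of distinct blocks of digits of length n in the base-b expansion of ξ. -/
open Filter

/-- The `k`-th digit (0-indexed; this is `a_{k+1}`) of the base-`b` expansion
of `ξ`, i.e. `a_j = ⌊b^j ξ⌋ mod b`. -/
noncomputable def digit (b : ℕ) (ξ : ℝ) (k : ℕ) : ℕ :=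
  (⌊ξ * (b : ℝ) ^ (k + 1)⌋ % (b : ℤ)).toNat

/-- Number of distinct factors of length `n` of the infinite word `x`. -/
noncomputable def complexity {A : Type*} (x : ℕ → A) (n : ℕ) : ℕ :=
  Set.ncard {w : Fin n → A | ∃ j : ℕ, ∀ k : Fin n, w k = x (j + k)}

/-- The set of lengths `m` of prefixes of `x` whose last `n` letters occur
a second time inside the prefix. -/
def returnSet {A : Type*} (x : ℕ → A) (n : ℕ) : Set ℕ :=
  {m : ℕ | ∃ i : ℕ, i + n < m ∧ ∀ k < n, x (i + k) = x (m - n + k)}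

/-- `r(n, x)`: the length of the smallest prefix of `x` containing two
(possibly overlapping) occurrences of some word of length `n`. -/
noncomputable def minReturn {A : Type*} (x : ℕ → A) (n : ℕ) : ℕ :=
  sInf (returnSet x n)

/-- The irrationality exponent of `ξ`, as an extended real: the supremum of
all real `μ` such that `|ξ - p/q| < q^(-μ)` has infinitely many rational
solutions `p/q` with `q ≥ 1`. -/
noncomputable def irrationalityExponent (ξ : ℝ) : EReal :=
  sSup {e : EReal | ∃ μ : ℝ, e = (μ : EReal) ∧
    {pq : ℤ × ℕ | 1 ≤ pq.2 ∧ |ξ - pq.1 / pq.2| < (pq.2 : ℝ) ^ (-μ)}.Infinite}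

/-- `x` reads the same `m` letters from position `w` and from position `w + v`. -/
def IsRepetition {A : Type*} (x : ℕ → A) (w v m : ℕ) : Prop :=
  0 < v ∧ ∀ k < m, x (w + k) = x (w + v + k)

/-- A repetition that cannot be extended to the right. -/
def IsMaxRepetition {A : Type*} (x : ℕ → A) (w v m : ℕ) : Prop :=
  IsRepetition x w v m ∧ x (w + m) ≠ x (w + v + m)

namespace IsRepetition

variable {A : Type*} {x : ℕ → A} {w v m w' v' m' : ℕ}

lemma mono (h : IsRepetition x w v m) (hm : m' ≤ m) : IsRepetition x w v m' :=
  ⟨h.1, fun k hk => h.2 k (hk.trans_le hm)⟩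

lemma apply_add (h : IsRepetition x w v m) {j : ℕ} (hw : w ≤ j) (hm : j < w + m) :
    x (j + v) = x j := by
  have := h.2 (j - w) (by omega)
  rw [show w + (j - w) = j by omega, show w + v + (j - w) = j + v by omega] at this
  exact this.symm

lemma exists_isMax (h : IsRepetition x w v m)
    (hx : ∀ w v, 0 < v → ∃ k, x (w + k) ≠ x (w + v + k)) :
    ∃ m', m ≤ m' ∧ IsMaxRepetition x w v m' := by
  classical
  have hex := hx w v h.1
  refine ⟨Nat.find hex, ?_, ⟨h.1, fun k hk => ?_⟩, Nat.find_spec hex⟩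
  · by_contra! hlt
    exact Nat.find_spec hex (h.2 _ hlt)
  · exact not_not.mp (Nat.find_min hex hk)

/-- Two repetitions with different periods `v < v'` force the period `v' - v` on the part of the
word preceding them. -/
lemma sub_period (h : IsRepetition x w v m) (h' : IsRepetition x w' v' m') (hv : v < v') {l : ℕ}
    (hl : max w w' + v' + l ≤ w + v + m) (hl' : max w w' + l ≤ w' + m') :
    IsRepetition x (max w w') (v' - v) l := by
  refine ⟨by omega, fun k hk => ?_⟩
  have h1 := h'.apply_add (j := max w w' + k) (by omega) (by omega)
  have h2 := h.apply_add (j := max w w' + (v' - v) + k) (by omega) (by omega)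
  rw [← h1, ← h2]
  congr 1
  omega

end IsRepetition

namespace IsMaxRepetition

variable {A : Type*} {x : ℕ → A} {w v m w' v' m' : ℕ}

lemma lt_add_max (h : IsMaxRepetition x w v m) (h' : IsRepetition x w' v' m')
    (hlt : w + v + m < w' + v' + m') : w + v + m < v + v' + max w w' := by
  by_contra! hle
  obtain ⟨h, hne⟩ := h
  have h1 := h'.apply_add (j := w + v + m - v') (by omega) (by omega)
  have h2 := h.apply_add (j := w + v + m - v' - v) (by omega) (by have := h'.1; omega)
  have h3 := h'.apply_add (j := w + v + m - v' - v) (by omega) (by omega)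
  rw [show w + v + m - v' + v' = w + v + m by omega] at h1
  rw [show w + v + m - v' - v + v = w + v + m - v' by omega] at h2
  rw [show w + v + m - v' - v + v' = w + m by omega] at h3
  exact hne (by rw [h1, h2, h3])

lemma min_lt (h : IsMaxRepetition x w v m) (h' : IsRepetition x w' v' m')
    (hlt : w + v + m < w' + v' + m') : min w w' + m < w' + v' := by
  have := h.lt_add_max h' hlt
  omega

lemma period_ne (h : IsMaxRepetition x w v m) (h' : IsRepetition x w' v' m')
    (hlt : w + v + m < w' + v' + m') (hw : w' ≤ m) : v ≠ v' := by
  rintro rfl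
  have := h'.apply_add (j := w + m) (by omega) (by omega)
  rw [show w + m + v = w + v + m by omega] at this
  exact h.2 this.symm

end IsMaxRepetition

section Complexity

variable {A : Type*} (x : ℕ → A)

/-- The factor of length `n` of `x` starting at position `j`. -/
def factorAt (n j : ℕ) : Fin n → A := fun k => x (j + k)

/-- The least position at which some factor of length `n` of `x` occurs for a second time. -/
noncomputable def firstReturn (n : ℕ) : ℕ :=
  sInf {c | ∃ w v, w + v = c ∧ IsRepetition x w v n}

variable {x}

lemma factorAt_eq_iff {n i j : ℕ} :
    factorAt x n i = factorAt x n j ↔ ∀ k < n, x (i + k) = x (j + k) := by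
  refine ⟨fun h k hk => congrFun h ⟨k, hk⟩, fun h => ?_⟩
  ext k
  exact h k k.2

lemma isRepetition_of_factorAt_eq {n i j : ℕ} (hij : i < j)
    (h : factorAt x n i = factorAt x n j) : IsRepetition x i (j - i) n := by
  refine ⟨by omega, fun k hk => ?_⟩
  rw [show i + (j - i) = j by omega]
  exact factorAt_eq_iff.1 h k hk

lemma complexity_eq (n : ℕ) : complexity x n = (Set.range (factorAt x n)).ncard := by
  unfold complexity
  congr 1
  ext u
  simp only [Set.mem_ofPred_eq, Set.mem_range, factorAt, funext_iff]
  exact exists_congr fun j => forall_congr' fun k => eq_comm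

lemma finite_range_factorAt (hx : (Set.range x).Finite) (n : ℕ) :
    (Set.range (factorAt x n)).Finite := by
  refine (Set.Finite.pi' (fun _ : Fin n => hx)).subset ?_
  rintro _ ⟨j, rfl⟩ k
  exact ⟨j + k, rfl⟩

lemma card_le_complexity (hx : (Set.range x).Finite) {n : ℕ} (s : Finset ℕ)
    (hs : Set.InjOn (factorAt x n) s) : s.card ≤ complexity x n := by
  rw [complexity_eq, ← Set.ncard_coe_finset, ← hs.ncard_image]
  exact Set.ncard_le_ncard (Set.image_subset_range _ _) (finite_range_factorAt hx n)

lemma exists_factorAt_eq (hx : (Set.range x).Finite) (n J : ℕ) :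
    ∃ i j, J < j ∧ i < j ∧ factorAt x n i = factorAt x n j := by
  have : Finite (Set.range (factorAt x n)) := finite_range_factorAt hx n
  obtain ⟨a, b, hne, hab⟩ := Finite.exists_ne_map_eq_of_infinite
    (fun t : ℕ => (⟨factorAt x n (J + 1 + t), Set.mem_range_self _⟩ : Set.range (factorAt x n)))
  have hab : factorAt x n (J + 1 + a) = factorAt x n (J + 1 + b) := congrArg Subtype.val hab
  rcases lt_or_gt_of_ne hne with h | h
  · exact ⟨_, _, by omega, by omega, hab⟩
  · exact ⟨_, _, by omega, by omega, hab.symm⟩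

lemma firstReturn_le {w v n : ℕ} (h : IsRepetition x w v n) : firstReturn x n ≤ w + v :=
  Nat.sInf_le ⟨w, v, rfl, h⟩

lemma firstReturn_spec (hx : (Set.range x).Finite) (n : ℕ) :
    ∃ w v, w + v = firstReturn x n ∧ IsRepetition x w v n := by
  refine Nat.sInf_mem (s := {c | ∃ w v, w + v = c ∧ IsRepetition x w v n}) ?_
  obtain ⟨i, j, -, hij, h⟩ := exists_factorAt_eq hx n 0
  exact ⟨_, i, j - i, rfl, isRepetition_of_factorAt_eq hij h⟩

lemma firstReturn_mono (hx : (Set.range x).Finite) {m n : ℕ} (hmn : m ≤ n) :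
    firstReturn x m ≤ firstReturn x n := by
  obtain ⟨w, v, hc, h⟩ := firstReturn_spec hx n
  exact hc ▸ firstReturn_le (h.mono hmn)

lemma injOn_factorAt_firstReturn (n : ℕ) :
    Set.InjOn (factorAt x n) (Finset.range (firstReturn x n)) := by
  have key : ∀ i j, i < j → j < firstReturn x n → factorAt x n i ≠ factorAt x n j := by
    intro i j hij hj h
    have := firstReturn_le (isRepetition_of_factorAt_eq hij h)
    omega
  intro i hi j hj h
  simp only [Finset.coe_range, Set.mem_Iio] at hi hj
  by_contra hne
  rcases lt_or_gt_of_ne hne with hlt | hlt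
  · exact key i j hlt hj h
  · exact key j i hlt hi h.symm

lemma firstReturn_le_complexity (hx : (Set.range x).Finite) (n : ℕ) :
    firstReturn x n ≤ complexity x n := by
  simpa using card_le_complexity hx _ (injOn_factorAt_firstReturn (x := x) n)

/-- After any position, new factors occur only until some factor reappears. -/
lemma exists_next_repetition (hx : (Set.range x).Finite) {n J : ℕ} (s : Finset ℕ)
    (hs : Set.InjOn (factorAt x n) s) (hJ : ∀ i ∈ s, i ≤ J) :
    ∃ (t w v : ℕ) (s' : Finset ℕ), w + v = J + 1 + t ∧ IsRepetition x w v n ∧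
      s'.card = s.card + t ∧ Set.InjOn (factorAt x n) s' ∧ ∀ i ∈ s', i ≤ J + t := by
  classical
  have hex : ∃ t, ∃ i < J + 1 + t, factorAt x n i = factorAt x n (J + 1 + t) := by
    obtain ⟨i, j, hj, hij, h⟩ := exists_factorAt_eq hx n J
    refine ⟨j - (J + 1), i, by omega, ?_⟩
    rwa [show J + 1 + (j - (J + 1)) = j by omega]
  obtain ⟨i, hi, h⟩ := Nat.find_spec hex
  have hmin : ∀ i j, i < j → J < j → j < J + 1 + Nat.find hex →
      factorAt x n i ≠ factorAt x n j := by
    intro i j hij hJj hj h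
    refine Nat.find_min hex (m := j - (J + 1)) (by omega) ⟨i, by omega, ?_⟩
    rwa [show J + 1 + (j - (J + 1)) = j by omega]
  have hdisj : Disjoint s (Finset.Ico (J + 1) (J + 1 + Nat.find hex)) := by
    rw [Finset.disjoint_left]
    intro a ha ha'
    have := hJ a ha
    simp only [Finset.mem_Ico] at ha'
    omega
  refine ⟨Nat.find hex, i, J + 1 + Nat.find hex - i,
    s ∪ Finset.Ico (J + 1) (J + 1 + Nat.find hex), by omega,
    isRepetition_of_factorAt_eq hi h, ?_, ?_, ?_⟩
  · rw [Finset.card_union_of_disjoint hdisj]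
    simp
  · have key : ∀ i j, i < j → i ∈ s ∪ Finset.Ico (J + 1) (J + 1 + Nat.find hex) →
        j ∈ s ∪ Finset.Ico (J + 1) (J + 1 + Nat.find hex) →
        factorAt x n i ≠ factorAt x n j := by
      intro i j hij hi hj h
      rw [Finset.mem_union, Finset.mem_Ico] at hi hj
      rcases hj with hj | hj
      · rcases hi with hi | hi
        · exact hij.ne (hs hi hj h)
        · have := hJ j hj
          omega
      · exact hmin i j hij (by omega) hj.2 h
    intro i hi j hj h
    by_contra hne
    rcases lt_or_gt_of_ne hne with hlt | hlt
    · exact key i j hlt hi hj h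
    · exact key j i hlt hj hi h.symm
  · intro a ha
    rw [Finset.mem_union, Finset.mem_Ico] at ha
    rcases ha with ha | ha
    · have := hJ a ha
      omega
    · omega

lemma exists_previous_repetition (hx : (Set.range x).Finite) {n : ℕ} (hn : 1 < firstReturn x n) :
    ∃ w v m, m < n ∧ IsMaxRepetition x w v m ∧ w + v = firstReturn x m ∧
      firstReturn x m < firstReturn x n ∧ firstReturn x (m + 1) = firstReturn x n := by
  classical
  have h0 : firstReturn x 0 < firstReturn x n := by
    refine (firstReturn_le (w := 0) (v := 1) ⟨one_pos, fun k hk => ?_⟩).trans_lt hn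
    omega
  let m := Nat.findGreatest (fun m => firstReturn x m < firstReturn x n) n
  have hm : firstReturn x m < firstReturn x n :=
    Nat.findGreatest_spec (P := fun m => firstReturn x m < firstReturn x n) (Nat.zero_le n) h0
  have hmn : m < n := by
    by_contra! h
    exact (firstReturn_mono hx h).not_gt hm
  have hm' : ¬ firstReturn x (m + 1) < firstReturn x n :=
    Nat.findGreatest_is_greatest (P := fun m => firstReturn x m < firstReturn x n)
      (Nat.lt_succ_self m) hmn
  obtain ⟨w, v, hc, h⟩ := firstReturn_spec hx m
  refine ⟨w, v, m, hmn, ⟨h, fun heq => ?_⟩, hc, hm,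
    le_antisymm (firstReturn_mono hx hmn) (not_lt.1 hm')⟩
  have : IsRepetition x w v (m + 1) := by
    refine ⟨h.1, fun k hk => ?_⟩
    rcases Nat.lt_succ_iff_lt_or_eq.1 hk with hk | rfl
    · exact h.2 k hk
    · exact heq
  have := firstReturn_le this
  omega

lemma complexity_lt_succ (hx : (Set.range x).Finite)
    (hper : ∀ w v, 0 < v → ∃ k, x (w + k) ≠ x (w + v + k)) (n : ℕ) :
    complexity x n < complexity x (n + 1) := by
  by_contra! hle
  let r : (Fin (n + 1) → A) → (Fin n → A) := fun u k => u k.castSucc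
  have hr : ∀ j, r (factorAt x (n + 1) j) = factorAt x n j := fun j => rfl
  have himg : r '' Set.range (factorAt x (n + 1)) = Set.range (factorAt x n) := by
    rw [← Set.range_comp]
    rfl
  have hinj : Set.InjOn r (Set.range (factorAt x (n + 1))) := by
    refine Set.injOn_of_ncard_image_eq ?_ (finite_range_factorAt hx _)
    refine le_antisymm (Set.ncard_image_le (finite_range_factorAt hx _)) ?_
    rw [himg, ← complexity_eq, ← complexity_eq]
    exact hle
  have hstep : ∀ i j, factorAt x n i = factorAt x n j →
      factorAt x n (i + 1) = factorAt x n (j + 1) := by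
    intro i j h
    have h' := hinj (Set.mem_range_self i) (Set.mem_range_self j) (by rw [hr, hr, h])
    rw [factorAt_eq_iff] at h' ⊢
    intro k hk
    have := h' (k + 1) (by omega)
    rwa [show i + (k + 1) = i + 1 + k by omega, show j + (k + 1) = j + 1 + k by omega] at this
  have hlast : ∀ i j, factorAt x n i = factorAt x n j → x i = x j := by
    intro i j h
    have h' := hinj (Set.mem_range_self i) (Set.mem_range_self j) (by rw [hr, hr, h])
    simpa using factorAt_eq_iff.1 h' 0 (by omega)
  obtain ⟨i, j, -, hij, h⟩ := exists_factorAt_eq hx n 0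
  obtain ⟨k, hk⟩ := hper i (j - i) (by omega)
  rw [show i + (j - i) = j by omega] at hk
  refine hk (hlast _ _ ?_)
  clear hk
  induction k with
  | zero => exact h
  | succ k ih => exact hstep _ _ ih

lemma complexity_add_le (hx : (Set.range x).Finite)
    (hper : ∀ w v, 0 < v → ∃ k, x (w + k) ≠ x (w + v + k)) {m n : ℕ} (hmn : m ≤ n) :
    complexity x m + n ≤ complexity x n + m := by
  induction n, hmn using Nat.le_induction with
  | base => rfl
  | succ n _ ih =>
    have := complexity_lt_succ hx hper n
    omega

end Complexity

section Digits

variable {b : ℕ} {ξ : ℝ}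

lemma digit_lt (hb : 2 ≤ b) (ξ : ℝ) (k : ℕ) : digit b ξ k < b := by
  unfold digit
  have := Int.emod_lt_of_pos ⌊ξ * (b : ℝ) ^ (k + 1)⌋ (b := b) (by omega)
  have := Int.emod_nonneg ⌊ξ * (b : ℝ) ^ (k + 1)⌋ (b := b) (by omega)
  omega

lemma finite_range_digit (hb : 2 ≤ b) (ξ : ℝ) : (Set.range (digit b ξ)).Finite := by
  refine (Set.finite_Iio b).subset ?_
  rintro _ ⟨k, rfl⟩
  exact digit_lt hb ξ k

lemma floor_mul_pow_succ (hb : 2 ≤ b) (ξ : ℝ) (k : ℕ) :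
    ⌊ξ * (b : ℝ) ^ (k + 1)⌋ = b * ⌊ξ * (b : ℝ) ^ k⌋ + digit b ξ k := by
  have hdiv : ⌊ξ * (b : ℝ) ^ (k + 1)⌋ / (b : ℤ) = ⌊ξ * (b : ℝ) ^ k⌋ := by
    rw [← Int.floor_div_natCast]
    congr 1
    have : (b : ℝ) ≠ 0 := by positivity
    field_simp
    ring
  have hnn := Int.emod_nonneg ⌊ξ * (b : ℝ) ^ (k + 1)⌋ (b := b) (by omega)
  rw [digit, Int.toNat_of_nonneg hnn, ← hdiv]
  exact (Int.mul_ediv_add_emod _ _).symm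

lemma floor_sub_floor_of_repetition (hb : 2 ≤ b) {w v m : ℕ}
    (h : IsRepetition (digit b ξ) w v m) :
    ⌊ξ * (b : ℝ) ^ (w + v + m)⌋ - ⌊ξ * (b : ℝ) ^ (w + m)⌋ =
      b ^ m * (⌊ξ * (b : ℝ) ^ (w + v)⌋ - ⌊ξ * (b : ℝ) ^ w⌋) := by
  induction m with
  | zero => simp
  | succ m ih =>
    have ih := ih (h.mono (Nat.le_succ m))
    rw [← add_assoc, ← add_assoc, floor_mul_pow_succ hb, floor_mul_pow_succ hb,
      h.2 m (Nat.lt_succ_self m), pow_succ']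
    linear_combination (b : ℤ) * ih

/-- A repetition in the expansion of `ξ` gives a good rational approximation of `ξ`. -/
lemma exists_approx_of_repetition (hb : 2 ≤ b) {w v m : ℕ}
    (h : IsRepetition (digit b ξ) w v m) :
    ∃ (p : ℤ) (q : ℕ), 1 ≤ q ∧ q ≤ b ^ (w + v) ∧
      |ξ - p / q| < b / (b : ℝ) ^ (w + v + m) := by
  have hv := h.1
  have hlt : b ^ w < b ^ (w + v) := Nat.pow_lt_pow_right (by omega) (by omega)
  refine ⟨⌊ξ * (b : ℝ) ^ (w + v)⌋ - ⌊ξ * (b : ℝ) ^ w⌋, b ^ (w + v) - b ^ w, by omega, by omega, ?_⟩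
  set P : ℤ := ⌊ξ * (b : ℝ) ^ (w + v)⌋ - ⌊ξ * (b : ℝ) ^ w⌋ with hP
  have hfl : (⌊ξ * (b : ℝ) ^ (w + v + m)⌋ : ℝ) - ⌊ξ * (b : ℝ) ^ (w + m)⌋ = (b : ℝ) ^ m * P := by
    have := congrArg (Int.cast : ℤ → ℝ) (floor_sub_floor_of_repetition hb h)
    rw [← hP] at this
    push_cast at this
    exact this
  have hb' : (2 : ℝ) ≤ b := by exact_mod_cast hb
  have hbm : (0 : ℝ) < (b : ℝ) ^ m := by positivity
  rw [Nat.cast_sub hlt.le]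
  push_cast
  have hQ : (0 : ℝ) < (b : ℝ) ^ (w + v) - (b : ℝ) ^ w := by
    have : ((b ^ w : ℕ) : ℝ) < ((b ^ (w + v) : ℕ) : ℝ) := by exact_mod_cast hlt
    push_cast at this
    linarith
  have hbQ : (b : ℝ) ^ (w + v) ≤ b * ((b : ℝ) ^ (w + v) - (b : ℝ) ^ w) := by
    have h1 : (b : ℝ) ^ (w + 1) ≤ (b : ℝ) ^ (w + v) :=
      pow_le_pow_right₀ (by linarith) (by omega)
    have h2 : (0 : ℝ) < (b : ℝ) ^ (w + v) := by positivity
    rw [pow_succ] at h1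
    nlinarith
  have hdiff : |ξ * ((b : ℝ) ^ (w + v) - (b : ℝ) ^ w) - P| * (b : ℝ) ^ m < 1 := by
    have e : (ξ * ((b : ℝ) ^ (w + v) - (b : ℝ) ^ w) - P) * (b : ℝ) ^ m =
        Int.fract (ξ * (b : ℝ) ^ (w + v + m)) - Int.fract (ξ * (b : ℝ) ^ (w + m)) := by
      rw [Int.fract, Int.fract, pow_add (b : ℝ) (w + v), pow_add (b : ℝ) w m]
      rw [pow_add (b : ℝ) (w + v), pow_add (b : ℝ) w m] at hfl
      linear_combination hfl
    rw [show ∀ y : ℝ, |y| * (b : ℝ) ^ m = |y * (b : ℝ) ^ m| from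
      fun y => by rw [abs_mul, abs_of_pos hbm], e]
    have h1 := Int.fract_nonneg (ξ * (b : ℝ) ^ (w + v + m))
    have h2 := Int.fract_lt_one (ξ * (b : ℝ) ^ (w + v + m))
    have h3 := Int.fract_nonneg (ξ * (b : ℝ) ^ (w + m))
    have h4 := Int.fract_lt_one (ξ * (b : ℝ) ^ (w + m))
    rw [abs_lt]
    constructor <;> linarith
  have hrw : ξ - P / ((b : ℝ) ^ (w + v) - (b : ℝ) ^ w) =
      (ξ * ((b : ℝ) ^ (w + v) - (b : ℝ) ^ w) - P) / ((b : ℝ) ^ (w + v) - (b : ℝ) ^ w) := by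
    field_simp
  rw [hrw, abs_div, abs_of_pos hQ, div_lt_div_iff₀ hQ (by positivity), pow_add (b : ℝ) (w + v)]
  have h2 : (0 : ℝ) < (b : ℝ) ^ (w + v) := by positivity
  calc _ = |ξ * ((b : ℝ) ^ (w + v) - (b : ℝ) ^ w) - P| * (b : ℝ) ^ m * (b : ℝ) ^ (w + v) := by ring
    _ < 1 * (b : ℝ) ^ (w + v) := by gcongr
    _ ≤ _ := by linarith

lemma finite_approx_of_irrationalityExponent_lt {ν : ℝ}
    (hν : irrationalityExponent ξ < (ν : EReal)) :
    {pq : ℤ × ℕ | 1 ≤ pq.2 ∧ |ξ - pq.1 / pq.2| < (pq.2 : ℝ) ^ (-ν)}.Finite := by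
  by_contra hinf
  exact hν.not_ge (le_sSup ⟨ν, rfl, hinf⟩)

lemma two_le_irrationalityExponent (hξ : Irrational ξ) : 2 ≤ irrationalityExponent ξ := by
  refine le_sSup ⟨2, by norm_cast, ?_⟩
  have hinf := Real.infinite_rat_abs_sub_lt_one_div_den_sq_of_irrational hξ
  refine (hinf.image (f := fun q : ℚ => (q.num, q.den)) ?_).mono ?_
  · intro q _ r _ h
    exact Rat.ext (congrArg Prod.fst h) (congrArg Prod.snd h)
  · rintro _ ⟨q, hq, rfl⟩
    refine ⟨q.pos, ?_⟩
    have hq : |ξ - q| < 1 / (q.den : ℝ) ^ 2 := hq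
    rw [Rat.cast_def] at hq
    rw [Real.rpow_neg (by positivity), ← one_div]
    exact_mod_cast hq

/-- The irrationality exponent bounds the length of a repetition, apart from short ones. -/
lemma exists_repetition_bound (hb : 2 ≤ b) (hξ : Irrational ξ) {ν : ℝ}
    (hν : irrationalityExponent ξ < (ν : EReal)) :
    ∃ C : ℕ, ∀ w v m, IsRepetition (digit b ξ) w v m → C < w + v + m →
      (m : ℝ) ≤ (ν - 1) * (w + v : ℕ) := by
  obtain ⟨κ, hκ, hκν⟩ := EReal.lt_iff_exists_real_btwn.1 hν
  have hκν : κ < ν := by exact_mod_cast hκν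
  have hκ0 : 0 ≤ κ := by
    have : ((2 : ℝ) : EReal) < κ := (two_le_irrationalityExponent hξ).trans_lt hκ
    have : (2 : ℝ) < κ := by exact_mod_cast this
    linarith
  have hb' : (1 : ℝ) < b := by exact_mod_cast hb
  have hfin := finite_approx_of_irrationalityExponent_lt hκ
  have hev : ∀ᶠ s : ℕ in atTop,
      ∀ pq ∈ {pq : ℤ × ℕ | 1 ≤ pq.2 ∧ |ξ - pq.1 / pq.2| < (pq.2 : ℝ) ^ (-κ)},
        b / (b : ℝ) ^ s < |ξ - pq.1 / pq.2| := by
    rw [eventually_all_finite hfin]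
    intro pq _
    have hpos : 0 < |ξ - pq.1 / pq.2| := by
      rw [abs_pos, sub_ne_zero]
      have := hξ.ne_rat (pq.1 / pq.2)
      push_cast at this
      exact this
    have : Tendsto (fun s : ℕ => (b : ℝ) / (b : ℝ) ^ s) atTop (nhds 0) :=
      (tendsto_pow_atTop_atTop_of_one_lt hb').const_div_atTop _
    exact this.eventually_lt_const hpos
  obtain ⟨N, hN⟩ := eventually_atTop.1 hev
  obtain ⟨M, hM⟩ := exists_nat_ge (1 + κ / (ν - κ))
  refine ⟨max N M, fun w v m h hs => ?_⟩
  obtain ⟨p, q, hq1, hqb, hlt⟩ := exists_approx_of_repetition hb h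
  have hnot : (q : ℝ) ^ (-κ) ≤ |ξ - p / q| := by
    by_contra! hmem
    exact (hN (w + v + m) (by omega) (p, q) ⟨hq1, hmem⟩).not_gt hlt
  have hq0 : (0 : ℝ) < q := by exact_mod_cast hq1
  have hqκ : (q : ℝ) ^ κ ≤ (b : ℝ) ^ (κ * (w + v : ℕ)) := by
    calc (q : ℝ) ^ κ ≤ ((b : ℝ) ^ (w + v)) ^ κ :=
          Real.rpow_le_rpow hq0.le (by exact_mod_cast hqb) hκ0
      _ = _ := by rw [← Real.rpow_natCast, ← Real.rpow_mul (by positivity), mul_comm]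
  have hpow : (b : ℝ) ^ ((w + v + m : ℕ) : ℝ) < (b : ℝ) ^ (1 + κ * (w + v : ℕ)) := by
    rw [Real.rpow_natCast, Real.rpow_add (by positivity), Real.rpow_one]
    have h1 := hnot.trans_lt hlt
    rw [Real.rpow_neg hq0.le, lt_div_iff₀ (by positivity), inv_mul_lt_iff₀ (by positivity)] at h1
    nlinarith
  have hexp := (Real.rpow_lt_rpow_left_iff hb').1 hpow
  have hsum : ((w + v + m : ℕ) : ℝ) = (w + v : ℕ) + m := Nat.cast_add _ _
  have hgap : 0 < ν - κ := by linarith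
  by_cases hc : 1 ≤ (ν - κ) * (w + v : ℕ)
  · linarith
  · exfalso
    have hsM : (M : ℝ) ≤ ((w + v + m : ℕ) : ℝ) := by
      exact_mod_cast (le_max_right N M).trans hs.le
    have : κ * (w + v : ℕ) ≤ κ / (ν - κ) := by
      rw [le_div_iff₀ hgap]
      nlinarith
    linarith

end Digits

section Estimates

variable {A : Type*} {x : ℕ → A} {w v m w' v' m' C : ℕ} {lam : ℝ}

/-- Two repetitions starting early with nearby second occurrences must be short: their periods
differ by a small amount, which is itself a period of a long factor starting early. -/
lemma length_le_of_two_repetitions (hlam : 1 ≤ lam)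
    (hC : ∀ w v m, IsRepetition x w v m → C < w + v + m → (m : ℝ) ≤ lam * (w + v : ℕ))
    (h : IsMaxRepetition x w v m) (h' : IsRepetition x w' v' m')
    (hle : w + v ≤ w' + v') (hlt : w + v + m < w' + v' + m') (hw : w' ≤ m) (hm : C < m) :
    (m : ℝ) ≤ (2 * lam + 1) * w + (lam + 1) * ((w' + v' : ℕ) - (w + v : ℕ)) ∨
      (m : ℝ) ≤ (2 * lam + 1) * w' := by
  have hleR : ((w + v : ℕ) : ℝ) ≤ (w' + v' : ℕ) := by exact_mod_cast hle
  have hw0 : (0 : ℝ) ≤ w := Nat.cast_nonneg _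
  have hw0' : (0 : ℝ) ≤ w' := Nat.cast_nonneg _
  push_cast at hleR ⊢
  rcases lt_or_gt_of_ne (h.period_ne h' hlt hw) with hv | hv
  · left
    have hvR : (v : ℝ) < v' := by exact_mod_cast hv
    have key : (m : ℝ) + w ≤ (lam + 1) * (max w w' + (v' - v)) := by
      by_cases hl : max w w' + v' ≤ w + v + m
      · obtain ⟨l, hl⟩ := Nat.exists_eq_add_of_le hl
        have := hC _ _ _ (h.1.sub_period h' hv (l := l) (by omega) (by omega)) (by omega)
        rw [Nat.cast_add, Nat.cast_sub hv.le] at this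
        have hl : (w : ℝ) + v + m = (max w w' : ℕ) + v' + l := by exact_mod_cast hl
        linarith
      · have hl : (w : ℝ) + v + m ≤ (max w w' : ℕ) + v' := by
          exact_mod_cast (not_le.1 hl).le
        have : 0 ≤ ((max w w' : ℕ) : ℝ) + (v' - v) :=
          add_nonneg (Nat.cast_nonneg _) (by linarith)
        nlinarith
    rw [Nat.cast_max] at key
    rcases le_total (w : ℝ) w' with hmax | hmax
    · rw [max_eq_right hmax] at key
      nlinarith
    · rw [max_eq_left hmax] at key
      nlinarith
  · right
    have hvR : (v' : ℝ) < v := by exact_mod_cast hv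
    have hww : w ≤ w' := by omega
    have hwwR : (w : ℝ) ≤ w' := by exact_mod_cast hww
    obtain ⟨l, hl⟩ := Nat.exists_eq_add_of_le (show w' ≤ w + m by omega)
    have hmax : max w' w = w' := max_eq_left hww
    have := hC _ _ _ (h'.sub_period h.1 hv (l := l) (by omega) (by omega)) (by omega)
    rw [hmax, Nat.cast_add, Nat.cast_sub hv.le] at this
    have hl : (w : ℝ) + m = w' + l := by exact_mod_cast hl
    nlinarith

variable {n H : ℝ}

lemma lt_of_density (hlam : 1 ≤ lam) (hH : 0 < H) (hn : 0 < n)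
    (hkey : H * ((lam + 1) ^ 3 * lam) < n * (1 - 2 * (lam + 1) * lam * (lam - 1))) :
    lam < 6 / 5 := by
  have h1 : 0 < 1 - 2 * (lam + 1) * lam * (lam - 1) := by
    refine pos_of_mul_pos_right (lt_trans ?_ hkey) hn.le
    positivity
  by_contra! h
  nlinarith [mul_nonneg (sub_nonneg.2 h) (sub_nonneg.2 hlam), mul_nonneg (mul_nonneg
    (sub_nonneg.2 h) (sub_nonneg.2 hlam)) (sub_nonneg.2 hlam)]

lemma false_of_density (hlam : 1 ≤ lam) (hH : 0 < H) (hn : 0 < n)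
    (hkey : H * ((lam + 1) ^ 3 * lam) < n * (1 - 2 * (lam + 1) * lam * (lam - 1)))
    {F G : ℝ} (hF : 0 < F) (hFG : F * n ≤ G * H)
    (hle : G * (1 - 2 * (lam + 1) * lam * (lam - 1)) ≤ F * ((lam + 1) ^ 3 * lam)) : False := by
  have h1 : 0 < 1 - 2 * (lam + 1) * lam * (lam - 1) := by
    refine pos_of_mul_pos_right (lt_trans ?_ hkey) hn.le
    positivity
  have a := mul_lt_mul_of_pos_left hkey hF
  have b := mul_le_mul_of_nonneg_right hFG h1.le
  have c := mul_le_mul_of_nonneg_left hle hH.le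
  nlinarith

lemma false_of_pair_one_two (hlam : 1 ≤ lam) (hH : 0 < H) (hn : 0 < n)
    (hkey : H * ((lam + 1) ^ 3 * lam) < n * (1 - 2 * (lam + 1) * lam * (lam - 1)))
    {m₁ c₁ c₂ w₁ w₂ : ℝ} (hnm : n ≤ m₁) (hm₁ : m₁ ≤ lam * c₁) (hc₁ : c₁ ≤ n + H)
    (hc₂ : c₂ ≤ m₁ + H) (hw₁ : w₁ ≤ H) (hw₂ : w₂ ≤ H + (m₁ - n))
    (h : m₁ ≤ (2 * lam + 1) * w₁ + (lam + 1) * (c₂ - c₁) ∨ m₁ ≤ (2 * lam + 1) * w₂) : False := by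
  have hlt := lt_of_density hlam hH hn hkey
  obtain ⟨s, rfl⟩ : ∃ s, lam = 1 + s := ⟨lam - 1, by ring⟩
  have hs : 0 ≤ s := by linarith
  have hs' : s ≤ 1 / 5 := by linarith
  have hs2 : s ^ 2 ≤ 1 / 5 * s := by nlinarith
  have hs3 : s ^ 3 ≤ 1 / 5 * s ^ 2 := by nlinarith [sq_nonneg s]
  rcases h with h | h
  · have hF : 0 < 1 - s - s ^ 2 := by nlinarith
    refine false_of_density hlam hH hn hkey (F := 1 - s - s ^ 2) (G := (5 + 3 * s) * (1 + s))
      hF ?_ ?_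
    · have h1 : m₁ ≤ (2 * s + 3) * H + (s + 2) * (m₁ + H) - (s + 2) * c₁ := by nlinarith
      have h2 : (1 + s) * m₁ ≤ (1 + s) * ((2 * s + 3) * H + (s + 2) * (m₁ + H)) -
          (s + 2) * m₁ := by nlinarith
      nlinarith
    · have e : (1 - s - s ^ 2) * ((1 + s + 1) ^ 3 * (1 + s)) - (5 + 3 * s) * (1 + s) *
          (1 - 2 * (1 + s + 1) * (1 + s) * (1 + s - 1)) =
          3 + 24 * s + 49 * s ^ 2 + 39 * s ^ 3 + s ^ 4 * (10 - 2 * s - s ^ 2) := by ring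
      have : 0 ≤ 10 - 2 * s - s ^ 2 := by nlinarith
      have : 0 ≤ 3 + 24 * s + 49 * s ^ 2 + 39 * s ^ 3 + s ^ 4 * (10 - 2 * s - s ^ 2) := by
        positivity
      linarith
  · have hF : 0 < 1 - 2 * s - 2 * s ^ 2 := by nlinarith
    refine false_of_density hlam hH hn hkey (F := 1 - 2 * s - 2 * s ^ 2)
      (G := 5 + 6 * s + 2 * s ^ 2) hF ?_ ?_
    · have h1 : m₁ ≤ (2 * s + 3) * (H + (m₁ - n)) := by nlinarith
      have h2 : m₁ ≤ (1 + s) * (n + H) := by nlinarith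
      nlinarith
    · have e : (1 - 2 * s - 2 * s ^ 2) * ((1 + s + 1) ^ 3 * (1 + s)) - (5 + 6 * s + 2 * s ^ 2) *
          (1 - 2 * (1 + s + 1) * (1 + s) * (1 + s - 1)) =
          3 + 18 * s + s ^ 2 * (14 - 15 * s - 25 * s ^ 2 - 12 * s ^ 3 - 2 * s ^ 3 * s) := by ring
      have : 0 ≤ 14 - 15 * s - 25 * s ^ 2 - 12 * s ^ 3 - 2 * s ^ 3 * s := by
        have := mul_nonneg hs (pow_nonneg hs 3)
        nlinarith [mul_le_mul hs3 hs' hs (by positivity)]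
      have : 0 ≤ 3 + 18 * s + s ^ 2 * (14 - 15 * s - 25 * s ^ 2 - 12 * s ^ 3 -
        2 * s ^ 3 * s) := by positivity
      linarith

lemma false_of_pair_zero_one (hlam : 1 ≤ lam) (hH : 0 < H) (hn : 0 < n)
    (hkey : H * ((lam + 1) ^ 3 * lam) < n * (1 - 2 * (lam + 1) * lam * (lam - 1)))
    {m₀ c₀ c₁ w₀ w₁ : ℝ} (hm₀ : m₀ ≤ lam * c₀) (hnc : n ≤ lam * c₁)
    (hc₁ : c₁ ≤ m₀ + H) (hw₀ : w₀ ≤ H) (hw₁ : w₁ ≤ H)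
    (h : m₀ ≤ (2 * lam + 1) * w₀ + (lam + 1) * (c₁ - c₀) ∨ m₀ ≤ (2 * lam + 1) * w₁) : False := by
  have hlt := lt_of_density hlam hH hn hkey
  obtain ⟨s, rfl⟩ : ∃ s, lam = 1 + s := ⟨lam - 1, by ring⟩
  have hs : 0 ≤ s := by linarith
  have hs' : s ≤ 1 / 5 := by linarith
  have hs2 : s ^ 2 ≤ 1 / 5 * s := by nlinarith
  have hnm : n ≤ (1 + s) * (m₀ + H) := by nlinarith
  have hF : 0 < 1 - s - s ^ 2 := by nlinarith
  refine false_of_density hlam hH hn hkey (F := 1 - s - s ^ 2)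
    (G := 6 + 13 * s + 9 * s ^ 2 + 2 * s ^ 3) hF ?_ ?_
  · have hbound : (1 - s - s ^ 2) * m₀ ≤ (5 + 3 * s) * (1 + s) * H := by
      rcases h with h | h
      · have h1 : m₀ ≤ (2 * s + 3) * H + (s + 2) * (m₀ + H) - (s + 2) * c₀ := by nlinarith
        have h2 : (1 + s) * m₀ ≤ (1 + s) * ((2 * s + 3) * H + (s + 2) * (m₀ + H)) -
            (s + 2) * m₀ := by nlinarith
        nlinarith
      · have h1 : m₀ ≤ (2 * s + 3) * H := by nlinarith
        calc (1 - s - s ^ 2) * m₀ ≤ (1 - s - s ^ 2) * ((2 * s + 3) * H) := by gcongr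
          _ ≤ _ := by
            have : 0 ≤ H * (2 + 9 * s + 8 * s ^ 2 + 2 * s ^ 3) := by positivity
            nlinarith
    have a := mul_le_mul_of_nonneg_left hnm hF.le
    have b := mul_le_mul_of_nonneg_left hbound (by linarith : (0 : ℝ) ≤ 1 + s)
    have hsH : 0 ≤ s * H := by positivity
    have hsH2 : 0 ≤ s ^ 2 * H := by positivity
    have hsH3 : 0 ≤ s ^ 3 * H := by positivity
    nlinarith
  · have e : (1 - s - s ^ 2) * ((1 + s + 1) ^ 3 * (1 + s)) -
        (6 + 13 * s + 9 * s ^ 2 + 2 * s ^ 3) *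
        (1 - 2 * (1 + s + 1) * (1 + s) * (1 + s - 1)) =
        2 + 23 * s + 69 * s ^ 2 + 93 * s ^ 3 + 64 * s ^ 4 + 22 * s ^ 5 + 3 * s ^ 6 := by ring
    have : 0 ≤ 2 + 23 * s + 69 * s ^ 2 + 93 * s ^ 3 + 64 * s ^ 4 + 22 * s ^ 5 + 3 * s ^ 6 := by
      positivity
    linarith

lemma false_of_pair_zero_two (hlam : 1 ≤ lam) (hH : 0 < H) (hn : 0 < n)
    (hkey : H * ((lam + 1) ^ 3 * lam) < n * (1 - 2 * (lam + 1) * lam * (lam - 1)))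
    {m₀ m₁ c₀ c₁ c₂ w₀ w₂ : ℝ} (hm₀ : m₀ ≤ lam * c₀) (hnm : n ≤ m₁) (hm₁ : m₁ ≤ lam * c₁)
    (hc₁ : c₁ ≤ m₀ + H) (hc₂ : c₂ ≤ m₁ + H) (hw₀ : w₀ ≤ H) (hw₂ : w₂ ≤ H)
    (h : m₀ ≤ (2 * lam + 1) * w₀ + (lam + 1) * (c₂ - c₀) ∨ m₀ ≤ (2 * lam + 1) * w₂) : False := by
  have hlt := lt_of_density hlam hH hn hkey
  obtain ⟨s, rfl⟩ : ∃ s, lam = 1 + s := ⟨lam - 1, by ring⟩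
  have hs : 0 ≤ s := by linarith
  have hs' : s ≤ 1 / 5 := by linarith
  have hs2 : s ^ 2 ≤ 1 / 5 * s := by nlinarith
  have hs3 : s ^ 3 ≤ 1 / 5 * s ^ 2 := by nlinarith [sq_nonneg s]
  have hm₁' : m₁ ≤ (1 + s) * (m₀ + H) := by nlinarith
  rcases h with h | h
  · have hF : 0 < 1 - 3 * s - 4 * s ^ 2 - s ^ 3 := by nlinarith
    refine false_of_density hlam hH hn hkey (F := 1 - 3 * s - 4 * s ^ 2 - s ^ 3)
      (G := 8 + 18 * s + 13 * s ^ 2 + 3 * s ^ 3) hF ?_ ?_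
    · have h1 : m₀ ≤ (2 * s + 3) * H + (s + 2) * ((1 + s) * (m₀ + H) + H) - (s + 2) * c₀ := by
        nlinarith
      have h2 : (1 + s) * m₀ ≤ (1 + s) * ((2 * s + 3) * H + (s + 2) * ((1 + s) * (m₀ + H) + H)) -
          (s + 2) * m₀ := by nlinarith
      have h3 := mul_le_mul_of_nonneg_left (hnm.trans hm₁') hF.le
      have h4 := mul_le_mul_of_nonneg_left h2 (by linarith : (0 : ℝ) ≤ 1 + s)
      nlinarith
    · have e : (1 - 3 * s - 4 * s ^ 2 - s ^ 3) * ((1 + s + 1) ^ 3 * (1 + s)) -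
          (8 + 18 * s + 13 * s ^ 2 + 3 * s ^ 3) *
          (1 - 2 * (1 + s + 1) * (1 + s) * (1 + s - 1)) =
          10 * s + 33 * s ^ 2 + 38 * s ^ 3 + s ^ 4 * (14 - 5 * s - 5 * s ^ 2 - s ^ 3) := by ring
      have : 0 ≤ 14 - 5 * s - 5 * s ^ 2 - s ^ 3 := by nlinarith
      have : 0 ≤ 10 * s + 33 * s ^ 2 + 38 * s ^ 3 +
        s ^ 4 * (14 - 5 * s - 5 * s ^ 2 - s ^ 3) := by positivity
      linarith
  · refine false_of_density hlam hH hn hkey (F := 1) (G := 2 * (1 + s) * (2 + s)) one_pos ?_ ?_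
    · have h1 : m₀ ≤ (2 * s + 3) * H := by nlinarith
      nlinarith
    · have e : 1 * ((1 + s + 1) ^ 3 * (1 + s)) - 2 * (1 + s) * (2 + s) *
          (1 - 2 * (1 + s + 1) * (1 + s) * (1 + s - 1)) =
          4 + 30 * s + 64 * s ^ 2 + 59 * s ^ 3 + 25 * s ^ 4 + 4 * s ^ 5 := by ring
      have : 0 ≤ 4 + 30 * s + 64 * s ^ 2 + 59 * s ^ 3 + 25 * s ^ 4 + 4 * s ^ 5 := by positivity
      linarith

lemma false_of_two_pairs (hlam : 1 ≤ lam) (hH : 0 < H) (hn : 0 < n)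
    (hkey : H * ((lam + 1) ^ 3 * lam) < n * (1 - 2 * (lam + 1) * lam * (lam - 1)))
    {m m₀ m₁ c c₀ c₁ c₃ w w₁ w₃ : ℝ} (hm : m ≤ lam * c) (hm₀ : m₀ ≤ lam * c₀)
    (hnm : n ≤ m₁) (hm₁ : m₁ ≤ lam * c₁) (hc₁n : c₁ ≤ n + H)
    (hc₀ : c₀ ≤ m + H) (hc₁ : c₁ ≤ m₀ + H) (hc₃ : c₃ ≤ (lam + 1) * m₁ + (lam + 1) * H - n)
    (hw : w ≤ H) (hw₁ : w₁ ≤ H) (hw₃ : w₃ ≤ H + (m₁ - n))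
    (h : m ≤ (2 * lam + 1) * w + (lam + 1) * (c₁ - c) ∨ m ≤ (2 * lam + 1) * w₁)
    (h' : m₁ ≤ (2 * lam + 1) * w₁ + (lam + 1) * (c₃ - c₁) ∨ m₁ ≤ (2 * lam + 1) * w₃) :
    False := by
  rcases h' with h' | h'
  swap
  · exact false_of_pair_one_two hlam hH hn hkey hnm hm₁ hc₁n (c₂ := m₁ + H) le_rfl hw₁ hw₃ (.inr h')
  have hlt := lt_of_density hlam hH hn hkey
  obtain ⟨s, rfl⟩ : ∃ s, lam = 1 + s := ⟨lam - 1, by ring⟩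
  have hs : 0 ≤ s := by linarith
  have hs' : s ≤ 1 / 5 := by linarith
  have hs2 : s ^ 2 ≤ 1 / 5 * s := by nlinarith
  have hs3 : s ^ 3 ≤ 1 / 5 * s ^ 2 := by nlinarith [sq_nonneg s]
  have hc₁m : c₁ ≤ (1 + s) * (m + H) + H := by
    linarith [mul_le_mul_of_nonneg_left hc₀ (by linarith : 0 ≤ 1 + s)]
  have hD : 0 < 1 - 3 * s - 4 * s ^ 2 - s ^ 3 := by nlinarith
  have hc₁H : (1 - 3 * s - 4 * s ^ 2 - s ^ 3) * c₁ ≤ (2 * s + 3) * (3 + 3 * s + s ^ 2) * H := by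
    rcases h with h | h
    · have h1 : m ≤ (2 * s + 3) * H + (s + 2) * c₁ - (s + 2) * c := by
        linarith [mul_le_mul_of_nonneg_left hw (by linarith : 0 ≤ 2 * s + 3)]
      have h2 : (1 + s) * m ≤ (1 + s) * ((2 * s + 3) * H + (s + 2) * c₁) -
          (s + 2) * m := by
        linarith [mul_le_mul_of_nonneg_left h1 (by linarith : 0 ≤ 1 + s),
          mul_le_mul_of_nonneg_left hm (by linarith : 0 ≤ s + 2)]
      have h3 := mul_le_mul_of_nonneg_left h2 (by linarith : (0 : ℝ) ≤ 1 + s)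
      have h4 := mul_le_mul_of_nonneg_left hc₁m (by linarith : (0 : ℝ) ≤ 2 * s + 3)
      linarith
    · have h1 : m ≤ (2 * s + 3) * H := by nlinarith
      have h2 : c₁ ≤ (2 * s ^ 2 + 6 * s + 5) * H := by
        linarith [mul_le_mul_of_nonneg_left h1 (by linarith : (0 : ℝ) ≤ 1 + s)]
      calc _ ≤ (1 - 3 * s - 4 * s ^ 2 - s ^ 3) * ((2 * s ^ 2 + 6 * s + 5) * H) := by gcongr
        _ ≤ 1 * ((2 * s ^ 2 + 6 * s + 5) * H) := by
          gcongr
          linarith [pow_nonneg hs 3, pow_nonneg hs 2]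
        _ ≤ _ := by
          have : 0 ≤ H * (4 + 9 * s + 7 * s ^ 2 + 2 * s ^ 3) := by positivity
          linarith
  have h1 : (s + 2) * n + (s + 2) * c₁ ≤ (s ^ 2 + 6 * s + 7) * H + (s ^ 2 + 4 * s + 3) * m₁ := by
    linarith [mul_le_mul_of_nonneg_left hw₁ (by linarith : 0 ≤ 2 * s + 3),
      mul_le_mul_of_nonneg_left hc₃ (by linarith : 0 ≤ s + 2)]
  have h2 : (s + 2) * n ≤ (s ^ 2 + 6 * s + 7) * H + (1 + 6 * s + 5 * s ^ 2 + s ^ 3) * c₁ := by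
    linarith [mul_le_mul_of_nonneg_left hm₁ (by positivity : 0 ≤ s ^ 2 + 4 * s + 3)]
  refine false_of_density hlam hH hn hkey (F := (s + 2) * (1 - 3 * s - 4 * s ^ 2 - s ^ 3))
    (G := (s ^ 2 + 6 * s + 7) * (1 - 3 * s - 4 * s ^ 2 - s ^ 3) +
      (1 + 6 * s + 5 * s ^ 2 + s ^ 3) * ((2 * s + 3) * (3 + 3 * s + s ^ 2))) (by positivity) ?_ ?_
  · have a := mul_le_mul_of_nonneg_left h2 hD.le
    have b := mul_le_mul_of_nonneg_left hc₁H
      (by positivity : 0 ≤ 1 + 6 * s + 5 * s ^ 2 + s ^ 3)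
    linarith
  · have e : (s + 2) * (1 - 3 * s - 4 * s ^ 2 - s ^ 3) * ((1 + s + 1) ^ 3 * (1 + s)) -
        ((s ^ 2 + 6 * s + 7) * (1 - 3 * s - 4 * s ^ 2 - s ^ 3) +
        (1 + 6 * s + 5 * s ^ 2 + s ^ 3) * ((2 * s + 3) * (3 + 3 * s + s ^ 2))) *
        (1 - 2 * (1 + s + 1) * (1 + s) * (1 + s - 1)) =
        10 * s + 61 * s ^ 2 + 302 * s ^ 3 + 705 * s ^ 4 + 854 * s ^ 5 + 583 * s ^ 6 +
        227 * s ^ 7 + 47 * s ^ 8 + 4 * s ^ 9 := by ring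
    have : 0 ≤ 10 * s + 61 * s ^ 2 + 302 * s ^ 3 + 705 * s ^ 4 + 854 * s ^ 5 + 583 * s ^ 6 +
        227 * s ^ 7 + 47 * s ^ 8 + 4 * s ^ 9 := by positivity
    linarith

end Estimates

section LowComplexity

variable {A : Type*} {x : ℕ → A} {lam : ℝ} {C : ℕ}

lemma exists_ne_of_repetition_bound
    (hC : ∀ w v m, IsRepetition x w v m → C < w + v + m → (m : ℝ) ≤ lam * (w + v : ℕ))
    (w v : ℕ) (hv : 0 < v) : ∃ k, x (w + k) ≠ x (w + v + k) := by
  by_contra! hper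
  obtain ⟨m, hm⟩ := exists_nat_gt (lam * (w + v : ℕ))
  have := hC w v (m + C + 1) ⟨hv, fun k _ => hper k⟩ (by omega)
  push_cast at this hm
  have : (0 : ℝ) ≤ C := by positivity
  linarith

lemma false_of_complexity_le (hx : (Set.range x).Finite) (hlam : 1 ≤ lam)
    (hC : ∀ w v m, IsRepetition x w v m → C < w + v + m → (m : ℝ) ≤ lam * (w + v : ℕ))
    {n : ℕ} (hn : 3 * C + 10 ≤ n) {H : ℝ} (hH : (complexity x n : ℝ) + 2 ≤ n + H)
    (hkey : H * ((lam + 1) ^ 3 * lam) < n * (1 - 2 * (lam + 1) * lam * (lam - 1))) : False := by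
  have hper := exists_ne_of_repetition_bound hC
  have hbound : ∀ {w v m}, IsRepetition x w v m → C < m → (m : ℝ) ≤ lam * (w + v : ℕ) :=
    fun h hm => hC _ _ _ h (by omega)
  have hnC : 3 * (C : ℝ) + 10 ≤ n := by exact_mod_cast hn
  have hC0 : (0 : ℝ) ≤ C := Nat.cast_nonneg _
  have hn0 : (0 : ℝ) < n := by linarith
  have hcomp : n ≤ complexity x n := by
    have := complexity_add_le hx hper (Nat.zero_le n)
    have : 0 < complexity x 0 := by
      refine lt_of_lt_of_le ?_ (firstReturn_le_complexity hx 0)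
      obtain ⟨w, v, hc, h⟩ := firstReturn_spec hx 0
      have := h.1
      omega
    omega
  have hH0 : 0 < H := by
    have : (n : ℝ) ≤ complexity x n := by exact_mod_cast hcomp
    linarith
  have hlam' := lt_of_density hlam hH0 hn0 hkey
  have hHn : 8 * H ≤ n := by
    have h1 : (8 : ℝ) ≤ (lam + 1) ^ 3 * lam := by
      calc (8 : ℝ) = (1 + 1) ^ 3 * 1 := by norm_num
        _ ≤ _ := by gcongr
    have h2 : 0 ≤ 2 * (lam + 1) * lam * (lam - 1) := by
      have : 0 ≤ lam - 1 := by linarith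
      positivity
    nlinarith [mul_le_mul_of_nonneg_left h1 hH0.le, mul_nonneg hn0.le h2]
  obtain ⟨w₁, v₁, hc₁, h₁⟩ := firstReturn_spec hx n
  obtain ⟨m₁, hnm₁, h₁⟩ := h₁.exists_isMax hper
  have hm₁ := hbound h₁.1 (by omega)
  have hnm₁R : (n : ℝ) ≤ m₁ := by exact_mod_cast hnm₁
  have hc₁n : n ≤ lam * (w₁ + v₁ : ℕ) := hnm₁R.trans hm₁
  have hc₁large : (n : ℝ) * (5 / 6) ≤ (w₁ + v₁ : ℕ) := by
    have : (0 : ℝ) ≤ (w₁ + v₁ : ℕ) := Nat.cast_nonneg _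
    nlinarith
  obtain ⟨w₀, v₀, m₀, hm₀n, h₀, hc₀, hc₀₁, hc₁'⟩ := exists_previous_repetition hx (n := n) (by
    rw [← hc₁]
    have : (1 : ℝ) < (w₁ + v₁ : ℕ) := by linarith
    exact_mod_cast this)
  have hstep₀ : ((w₁ + v₁ : ℕ) : ℝ) ≤ m₀ + H := by
    have h1 := firstReturn_le_complexity hx (m₀ + 1)
    have h2 := complexity_add_le hx hper (show m₀ + 1 ≤ n from hm₀n)
    have : ((w₁ + v₁ : ℕ) : ℝ) + n ≤ complexity x n + m₀ + 1 := by
      exact_mod_cast (by omega : w₁ + v₁ + n ≤ complexity x n + m₀ + 1)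
    linarith
  have hm₀C : C < m₀ := by
    have : (C : ℝ) < m₀ := by linarith
    exact_mod_cast this
  have hm₀ := hbound h₀.1 hm₀C
  have hc₀large : (m₀ : ℝ) * (5 / 6) ≤ (w₀ + v₀ : ℕ) := by
    have : (0 : ℝ) ≤ (w₀ + v₀ : ℕ) := Nat.cast_nonneg _
    nlinarith
  obtain ⟨w, v, m, hmm₀, h, hc, hcc₀, hc₀'⟩ := exists_previous_repetition hx (n := m₀) (by
    rw [← hc₀]
    have : (1 : ℝ) < (w₀ + v₀ : ℕ) := by linarith
    exact_mod_cast this)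
  have hstep : ((w₀ + v₀ : ℕ) : ℝ) ≤ m + H := by
    have h1 := firstReturn_le_complexity hx (m + 1)
    have h2 := complexity_add_le hx hper (show m + 1 ≤ n by omega)
    have : ((w₀ + v₀ : ℕ) : ℝ) + n ≤ complexity x n + m + 1 := by
      exact_mod_cast (by omega : w₀ + v₀ + n ≤ complexity x n + m + 1)
    linarith
  have hmC : C < m := by
    have : (C : ℝ) < m := by linarith
    exact_mod_cast this
  have hm := hbound h.1 hmC
  obtain ⟨t, w₂, v₂, s, hc₂, h₂, hs, hsinj, hsle⟩ := exists_next_repetition hx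
    (J := w₁ + v₁ + m₁ - n) _ (injOn_factorAt_firstReturn (x := x) n) (fun i hi => by
      rw [Finset.mem_range] at hi
      omega)
  rw [Finset.card_range] at hs
  obtain ⟨m₂, hnm₂, h₂⟩ := h₂.exists_isMax hper
  have hm₂ := hbound h₂.1 (by omega)
  obtain ⟨t', w₃, v₃, s', hc₃, h₃, hs', hs'inj, -⟩ := exists_next_repetition hx
    (J := w₂ + v₂ + m₂ - n) s hsinj (fun i hi => (hsle i hi).trans (by omega))
  have hcard : ((w₁ + v₁ : ℕ) : ℝ) + t + t' ≤ complexity x n := by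
    have := card_le_complexity hx s' hs'inj
    exact_mod_cast (by omega : w₁ + v₁ + t + t' ≤ complexity x n)
  have ht : (0 : ℝ) ≤ t := Nat.cast_nonneg _
  have ht' : (0 : ℝ) ≤ t' := Nat.cast_nonneg _
  have hc₂R : ((w₂ + v₂ : ℕ) : ℝ) + n = (w₁ + v₁ : ℕ) + m₁ + 1 + t := by
    exact_mod_cast (by omega : w₂ + v₂ + n = w₁ + v₁ + m₁ + 1 + t)
  have hc₃R : ((w₃ + v₃ : ℕ) : ℝ) + n = (w₂ + v₂ : ℕ) + m₂ + 1 + t' := by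
    exact_mod_cast (by omega : w₃ + v₃ + n = w₂ + v₂ + m₂ + 1 + t')
  have hc₁H : ((w₁ + v₁ : ℕ) : ℝ) ≤ n + H := by linarith
  have hstep₁ : ((w₂ + v₂ : ℕ) : ℝ) ≤ m₁ + H := by linarith
  have hstep₂ : ((w₃ + v₃ : ℕ) : ℝ) ≤ m₂ + (H + (m₁ - n)) := by linarith
  have hmin : ∀ {a b k c : ℕ} {K : ℝ}, min a b + k < c → (c : ℝ) ≤ k + K → K < a →
      (b : ℝ) ≤ K := by
    intro a b k c K h1 h2 h3
    have h1 : ((min a b : ℕ) : ℝ) + k < c := by exact_mod_cast h1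
    rw [Nat.cast_min] at h1
    have h4 : min (a : ℝ) b < K := by linarith
    exact ((min_lt_iff.1 h4).resolve_left h3.not_gt).le
  have hw_le : ∀ {a k : ℕ}, (a : ℝ) ≤ H + (m₁ - n) → m₁ ≤ k → a ≤ k := by
    intro a k ha hk
    have : (a : ℝ) ≤ m₁ := by linarith
    exact (Nat.cast_le.1 this).trans hk
  have hmin₀ := h₀.min_lt h₁.1 (by omega)
  have hmR : (m : ℝ) ≤ m₀ := by exact_mod_cast hmm₀.le
  have hHm : H ≤ m := by linarith
  by_cases hw₁ : (w₁ : ℝ) ≤ H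
  · by_cases hw₂ : (w₂ : ℝ) ≤ H + (m₁ - n)
    · exact false_of_pair_one_two hlam hH0 hn0 hkey hnm₁R hm₁ hc₁H hstep₁ hw₁ hw₂
        (length_le_of_two_repetitions hlam hC h₁ h₂.1 (by omega) (by omega)
          (hw_le hw₂ le_rfl) (by omega))
    · by_cases hw₀ : (w₀ : ℝ) ≤ H
      · exact false_of_pair_zero_one hlam hH0 hn0 hkey hm₀ hc₁n hstep₀ hw₀ hw₁
          (length_le_of_two_repetitions hlam hC h₀ h₁.1 (by omega) (by omega)
            (by exact_mod_cast (hw₁.trans hHm).trans hmR) hm₀C)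
      · have hw : (w : ℝ) ≤ H := by
          refine hmin (a := w₀) (k := m) ?_ hstep (not_le.1 hw₀)
          rw [min_comm]
          exact h.min_lt h₀.1 (by omega)
        have hw₃ : (w₃ : ℝ) ≤ H + (m₁ - n) :=
          hmin (h₂.min_lt h₃ (by omega)) hstep₂ (not_le.1 hw₂)
        have hc₃' : ((w₃ + v₃ : ℕ) : ℝ) ≤ (lam + 1) * m₁ + (lam + 1) * H - n := by
          have h1 : (lam + 1) * ((w₁ + v₁ : ℕ) + 1 + t + 1 + t' - n) ≤ (lam + 1) * H :=
            mul_le_mul_of_nonneg_left (by linarith) (by linarith)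
          have h2 : lam * (w₂ + v₂ : ℕ) = lam * ((w₁ + v₁ : ℕ) + m₁ + 1 + t - n) := by
            rw [← hc₂R]
            ring
          have h3 : 0 ≤ lam * (1 + t') := by positivity
          linarith
        exact false_of_two_pairs hlam hH0 hn0 hkey hm hm₀ hnm₁R hm₁ hc₁H hstep hstep₀ hc₃'
          hw hw₁ hw₃
          (length_le_of_two_repetitions hlam hC h h₁.1 (by omega) (by omega)
            (by exact_mod_cast hw₁.trans hHm) hmC)
          (length_le_of_two_repetitions hlam hC h₁ h₃ (by omega) (by omega)
            (hw_le hw₃ le_rfl) (by omega))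
  · have hw₀ : (w₀ : ℝ) ≤ H := by
      refine hmin (a := w₁) (k := m₀) ?_ hstep₀ (not_le.1 hw₁)
      rw [min_comm]
      exact hmin₀
    have hw₂ : (w₂ : ℝ) ≤ H := hmin (h₁.min_lt h₂.1 (by omega)) hstep₁ (not_le.1 hw₁)
    exact false_of_pair_zero_two hlam hH0 hn0 hkey hm₀ hnm₁R hm₁ hstep₀ hstep₁ hw₀ hw₂
      (length_le_of_two_repetitions hlam hC h₀ h₂.1 (by omega) (by omega)
        (by exact_mod_cast (hw₂.trans hHm).trans hmR) hm₀C)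

end LowComplexity

theorem stmt10 {b : ℕ} (hb : 2 ≤ b) (ξ : ℝ) (hξ : Irrational ξ) (μ : ℝ)
    (hμ : irrationalityExponent ξ = (μ : EReal)) :
    ((1 + (1 - 2 * μ * (μ - 1) * (μ - 2)) / (μ ^ 3 * (μ - 1)) : ℝ) : EReal) ≤
      liminf (fun n : ℕ => (((complexity (digit b ξ) n : ℝ) / n : ℝ) : EReal)) atTop := by
  have hμ2 : 2 ≤ μ := by
    have : ((2 : ℝ) : EReal) ≤ μ := hμ ▸ two_le_irrationalityExponent hξ
    exact_mod_cast this
  by_contra! hlt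
  obtain ⟨a, ha, haμ⟩ := EReal.lt_iff_exists_real_btwn.1 hlt
  have haμ : a < 1 + (1 - 2 * μ * (μ - 1) * (μ - 2)) / (μ ^ 3 * (μ - 1)) := by
    exact_mod_cast haμ
  have hcont : ContinuousAt
      (fun y : ℝ => 1 + (1 - 2 * y * (y - 1) * (y - 2)) / (y ^ 3 * (y - 1))) μ := by
    have : μ ^ 3 * (μ - 1) ≠ 0 := by
      have : 0 < μ - 1 := by linarith
      positivity
    fun_prop (disch := assumption)
  have hev : ∀ᶠ y in nhdsWithin μ (Set.Ioi μ),
      a < 1 + (1 - 2 * y * (y - 1) * (y - 2)) / (y ^ 3 * (y - 1)) :=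
    nhdsWithin_le_nhds (hcont.eventually_const_lt haμ)
  obtain ⟨ν, hνa, hμν : μ < ν⟩ := (hev.and self_mem_nhdsWithin).exists
  have hν1 : 0 < ν - 1 := by linarith
  have hν0 : 0 < ν := by linarith
  have hK : 0 < ν ^ 3 * (ν - 1) := by positivity
  obtain ⟨C, hC⟩ := exists_repetition_bound hb hξ (hμ ▸ (by exact_mod_cast hμν) :
    irrationalityExponent ξ < (ν : EReal))
  obtain ⟨N, hN⟩ := exists_nat_gt
    (2 / (1 + (1 - 2 * ν * (ν - 1) * (ν - 2)) / (ν ^ 3 * (ν - 1)) - a))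
  obtain ⟨n, han, hn⟩ := ((frequently_lt_of_liminf_lt (by isBoundedDefault) ha).and_eventually
    (eventually_ge_atTop (3 * C + 10 + N))).exists
  have han : (complexity (digit b ξ) n : ℝ) / n < a := by exact_mod_cast han
  have hn0 : (0 : ℝ) < n := by exact_mod_cast (by omega : 0 < n)
  rw [div_lt_iff₀ hn0] at han
  have hNn : (N : ℝ) ≤ n := by exact_mod_cast (by omega : N ≤ n)
  have hgap := hN.trans_le hNn
  rw [div_lt_iff₀ (by linarith)] at hgap
  have hH : complexity (digit b ξ) n + 2 - n <
      n * (1 - 2 * ν * (ν - 1) * (ν - 2)) / (ν ^ 3 * (ν - 1)) := by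
    rw [mul_div_assoc]
    linarith
  rw [lt_div_iff₀ hK] at hH
  refine false_of_complexity_le (finite_range_digit hb ξ) (by linarith) hC
    (by omega : 3 * C + 10 ≤ n) (H := complexity (digit b ξ) n + 2 - n) (by linarith) ?_
  rw [sub_add_cancel]
  linarith
end

section
/- Every irrational real number ξ whose irrationality exponent equals 2 satisfies limsup_{n→∞} r(n, ξ, b)/n ≥ 15/7 for every integer base b ≥ 2, where r(n, ξ, b) is the length of the smallest prefix of the base-b digit sequence of ξ containing two occurrences of some block of length n. -/
open Filter

/-- `x` has local period `s` on the window starting at `i`, and the block of length `N` at `i` is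
the longest one that reappears at `i + s`. -/
def IsMaximalRepeat {A : Type*} (x : ℕ → A) (i s N : ℕ) : Prop :=
  0 < s ∧ (∀ y, i ≤ y → y < i + N → x y = x (y + s)) ∧ x (i + N) ≠ x (i + N + s)

section Combinatorics

variable {A : Type*} {x : ℕ → A}

lemma minReturn_le_of_repeat {i s N : ℕ} (hs : 0 < s)
    (h : ∀ y, i ≤ y → y < i + N → x y = x (y + s)) : minReturn x N ≤ i + s + N := by
  refine Nat.sInf_le ⟨i, by omega, fun k hk => ?_⟩
  rw [h (i + k) (by omega) (by omega)]
  congr 1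
  omega

lemma returnSet_nonempty (hx : (Set.range x).Finite) (n : ℕ) : (returnSet x n).Nonempty := by
  have := hx.to_subtype
  obtain ⟨i, j, hij, h⟩ := Finite.exists_ne_map_eq_of_infinite
    (fun i : ℕ => fun k : Fin n => Set.rangeFactorization x (i + k))
  wlog hlt : i < j generalizing i j
  · exact this j i hij.symm h.symm (by omega)
  refine ⟨j + n, i, by omega, fun k hk => ?_⟩
  simpa using congrArg Subtype.val (congrFun h ⟨k, hk⟩)

lemma exists_repeat_of_minReturn {n : ℕ} (h : (returnSet x n).Nonempty) :
    ∃ i s, 0 < s ∧ (∀ y, i ≤ y → y < i + n → x y = x (y + s)) ∧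
      minReturn x n = i + s + n := by
  obtain ⟨i, hi, hx⟩ := Nat.sInf_mem h
  change i + n < minReturn x n at hi
  refine ⟨i, minReturn x n - n - i, by omega, fun y hy hyn => ?_, by omega⟩
  have := hx (y - i) (by omega)
  change x (i + (y - i)) = x (minReturn x n - n + (y - i)) at this
  rw [show i + (y - i) = y by omega] at this
  rw [this]
  congr 1
  omega

lemma minReturn_succ (h : ∀ n, (returnSet x n).Nonempty) (n : ℕ) :
    minReturn x n + 1 ≤ minReturn x (n + 1) := by
  obtain ⟨i, s, hs, hx, hr⟩ := exists_repeat_of_minReturn (h (n + 1))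
  have := minReturn_le_of_repeat (N := n) hs (fun y hy hyn => hx y hy (by omega))
  omega

lemma minReturn_add (h : ∀ n, (returnSet x n).Nonempty) (n d : ℕ) :
    minReturn x n + d ≤ minReturn x (n + d) := by
  induction d with
  | zero => simp
  | succ d ih =>
    have := minReturn_succ h (n + d)
    rw [← add_assoc n d 1]
    omega

lemma repeat_length_le {n₀ i s N : ℕ} (hlow : ∀ n ≥ n₀, 1999 * n ≤ 1000 * minReturn x n)
    (hs : 0 < s) (h : ∀ y, i ≤ y → y < i + N → x y = x (y + s)) :
    999 * N ≤ 1000 * (i + s) + 999 * n₀ := by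
  have h1 := minReturn_le_of_repeat hs h
  by_cases hN : n₀ ≤ N
  · have := hlow N hN
    omega
  · omega

lemma exists_maximalRepeat {n₀ m : ℕ} (hlow : ∀ n ≥ n₀, 1999 * n ≤ 1000 * minReturn x n)
    (hne : ∀ n, (returnSet x n).Nonempty) :
    ∃ i s N, IsMaximalRepeat x i s N ∧ m ≤ N ∧ minReturn x m = i + s + m := by
  classical
  obtain ⟨i, s, hs, hx, hr⟩ := exists_repeat_of_minReturn (hne m)
  have hex : ∃ N, x (i + N) ≠ x (i + N + s) := by
    by_contra! hall
    have := repeat_length_le (i := i) (N := 1000 * (i + s) + 999 * n₀ + 1) hlow hs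
      (fun y hy _ => by
        have := hall (y - i)
        rwa [show i + (y - i) = y by omega] at this)
    omega
  refine ⟨i, s, Nat.find hex, ⟨hs, fun y hy hyN => ?_, Nat.find_spec hex⟩, ?_, hr⟩
  · have := Nat.find_min hex (show y - i < Nat.find hex by omega)
    rw [show i + (y - i) = y by omega] at this
    exact not_not.mp this
  · by_contra hlt
    exact Nat.find_spec hex (hx (i + Nat.find hex) (by omega) (by omega))

namespace IsMaximalRepeat

variable {i s N i' s' N' : ℕ}

/-- A weak form of the Fine–Wilf theorem: two maximal repeats with different ends cannot
overlap on a window as long as the sum of their periods. -/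
lemma overlap_lt (h : IsMaximalRepeat x i s N) (h' : IsMaximalRepeat x i' s' N')
    (hend : i + s + N < i' + s' + N') {I : ℕ} (hi : i ≤ I) (hi' : i' ≤ I) :
    i + N < I + s' := by
  by_contra! hle
  obtain ⟨hs, hp, hmis⟩ := h
  obtain ⟨hs', hp', -⟩ := h'
  obtain ⟨y, hy⟩ := Nat.exists_eq_add_of_le hle
  have e1 := hp (I + y) (by omega) (by omega)
  have e2 := hp' (I + y + s) (by omega) (by omega)
  have e3 := hp' (I + y) (by omega) (by omega)
  apply hmis
  rw [show i + N = I + y + s' by omega, ← e3, e1, e2]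
  congr 1
  omega

lemma period_ne (h : IsMaximalRepeat x i s N) (h' : IsMaximalRepeat x i' s' N')
    (hend : i + s + N < i' + s' + N') (hi : i' ≤ i + N) : s ≠ s' := by
  rintro rfl
  exact h.2.2 (h'.2.1 _ hi (by omega))

lemma length_le_of_period_lt {n₀ : ℕ}
    (hlow : ∀ n ≥ n₀, 1999 * n ≤ 1000 * minReturn x n)
    (h : IsMaximalRepeat x i s N) (h' : IsMaximalRepeat x i' s' N')
    (hend : i + s + N < i' + s' + N') {t : ℕ} (ht : 0 < t) (hst : s + t = s')
    {I : ℕ} (hi : i ≤ I) (hi' : i' ≤ I) :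
    999 * (i + N) ≤ 1999 * (I + t) + 999 * n₀ := by
  have := repeat_length_le (x := x) (i := I) (s := t) (N := i + N - t - I) hlow ht
    (fun y hy hyN => by
      rw [h'.2.1 y (by omega) (by omega), h.2.1 (y + t) (by omega) (by omega)]
      congr 1
      omega)
  omega

lemma length_le_of_lt_period {n₀ : ℕ}
    (hlow : ∀ n ≥ n₀, 1999 * n ≤ 1000 * minReturn x n)
    (h : IsMaximalRepeat x i s N) (h' : IsMaximalRepeat x i' s' N')
    (hend : i + s + N < i' + s' + N') {t : ℕ} (ht : 0 < t) (hst : s' + t = s)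
    (hi : i ≤ i') :
    999 * (i + s + N) ≤ 999 * (i' + s') + 1999 * t + 1000 * i' + 999 * n₀ := by
  have := repeat_length_le (x := x) (i := i') (s := t) (N := i + N - i') hlow ht
    (fun y hy hyN => by
      rw [h.2.1 y (by omega) (by omega), h'.2.1 (y + t) (by omega) (by omega)]
      congr 1
      omega)
  omega

lemma consecutive {n₀ : ℕ} (hlow : ∀ n ≥ n₀, 1999 * n ≤ 1000 * minReturn x n)
    (hN : 1000000 * (n₀ + 1) ≤ N)
    (h : IsMaximalRepeat x i s N) (h' : IsMaximalRepeat x i' s' N')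
    (hNN : N + 1 ≤ N') (hj : i + s ≤ i' + s') (hup : 7 * (i' + s') ≤ 8 * (N + 1)) :
    (i' < i ∧ i' + N < i' + s' ∧ N ≤ 5 * i) ∨
      (i < i' ∧ i + N < i' + s' ∧ 3 * N ≤ 10 * i') := by
  have hlen := repeat_length_le hlow h.1 h.2.1
  have hne := h.period_ne h' (by omega)
  rcases lt_trichotomy s s' with hlt | heq | hgt
  · obtain ⟨t, rfl⟩ := Nat.exists_eq_add_of_lt hlt
    rcases le_or_gt i i' with hii | hii
    · have h1 := h.length_le_of_period_lt hlow h' (by omega) (t := t + 1) (by omega) (by omega)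
        hii le_rfl
      have h2 := h.overlap_lt h' (by omega) hii le_rfl
      omega
    · have h1 := h.length_le_of_period_lt hlow h' (by omega) (t := t + 1) (by omega) (by omega)
        le_rfl hii.le
      have h2 := h.overlap_lt h' (by omega) le_rfl hii.le
      left
      omega
  · omega
  · obtain ⟨t, rfl⟩ := Nat.exists_eq_add_of_lt hgt
    have h1 := h.length_le_of_lt_period hlow h' (by omega) (t := t + 1) (by omega) (by omega)
      (by omega)
    have h2 := h.overlap_lt h' (I := i') (by omega) (by omega) le_rfl
    right
    omega

lemma false_of_small_starts {n₀ N₀ j₂ N₂ : ℕ}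
    (hlow : ∀ n ≥ n₀, 1999 * n ≤ 1000 * minReturn x n)
    (hN₀ : 1000000 * (n₀ + 1) ≤ N₀)
    (h : IsMaximalRepeat x i s N) (h' : IsMaximalRepeat x i' s' N')
    (hNN₀ : N₀ + 1 ≤ N) (hNN : N + 1 ≤ N₂) (hNN' : N₂ + 1 ≤ N')
    (hj : 7 * (i + s) ≤ 8 * (N₀ + 1)) (hj₂ : 7 * j₂ ≤ 8 * (N + 1))
    (hN₂ : 999 * N₂ ≤ 1000 * j₂ + 999 * n₀) (hj' : 7 * (i' + s') ≤ 8 * (N₂ + 1))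
    (hjj' : i + s ≤ i' + s') (hi : i + N₀ < i + s) (hi' : i' + N₂ < i' + s') : False := by
  have hlen := repeat_length_le hlow h.1 h.2.1
  have hne := h.period_ne h' (by omega)
  rcases lt_trichotomy s s' with hlt | heq | hgt
  · obtain ⟨t, rfl⟩ := Nat.exists_eq_add_of_lt hlt
    rcases le_or_gt i i' with hii | hii
    · have h1 := h.length_le_of_period_lt hlow h' (by omega) (t := t + 1) (by omega) (by omega)
        hii le_rfl
      omega
    · have h1 := h.length_le_of_period_lt hlow h' (by omega) (t := t + 1) (by omega) (by omega)
        le_rfl hii.le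
      omega
  · omega
  · obtain ⟨t, rfl⟩ := Nat.exists_eq_add_of_lt hgt
    have h1 := h.length_le_of_lt_period hlow h' (by omega) (t := t + 1) (by omega) (by omega)
      (by omega)
    omega

end IsMaximalRepeat

theorem false_of_minReturn_bounds {n₀ : ℕ} (hne : ∀ n, (returnSet x n).Nonempty)
    (hlow : ∀ n ≥ n₀, 1999 * n ≤ 1000 * minReturn x n)
    (hup : ∀ n ≥ n₀, 7 * minReturn x n ≤ 15 * n) : False := by
  choose i s N hrep hmN hr using fun m => exists_maximalRepeat (m := m) hlow hne
  let m : ℕ → ℕ := fun k => Nat.rec (1000000 * (n₀ + 1)) (fun _ p => N p + 1) k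
  have hm : ∀ k, m (k + 1) = N (m k) + 1 := fun _ => rfl
  have hM : ∀ k, 1000000 * (n₀ + 1) ≤ m k := by
    intro k
    induction k with
    | zero => exact le_rfl
    | succ k ih =>
      have := hmN (m k)
      rw [hm]
      omega
  have hMN : ∀ k, 1000000 * (n₀ + 1) ≤ N (m k) := fun k => (hM k).trans (hmN _)
  have hNN : ∀ k, N (m k) + 1 ≤ N (m (k + 1)) := fun k => hmN (m (k + 1))
  have hj : ∀ k, i (m k) + s (m k) ≤ i (m (k + 1)) + s (m (k + 1)) := by
    intro k
    have h1 := minReturn_add hne (m k) (N (m k) + 1 - m k)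
    rw [Nat.add_sub_cancel' (by have := hmN (m k); omega), ← hm, hr, hr] at h1
    have h2 := hmN (m k)
    have h3 := hm k
    omega
  have hju : ∀ k, 7 * (i (m (k + 1)) + s (m (k + 1))) ≤ 8 * (N (m k) + 1) := by
    intro k
    have h1 := hup (m (k + 1)) (by have := hM (k + 1); omega)
    rw [hr] at h1
    have h3 := hm k
    omega
  have hlen : ∀ k, 999 * N (m k) ≤ 1000 * (i (m k) + s (m k)) + 999 * n₀ := fun k =>
    repeat_length_le hlow (hrep (m k)).1 (hrep (m k)).2.1
  have hcons := fun k =>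
    (hrep (m k)).consecutive hlow (hMN k) (hrep (m (k + 1))) (hNN k) (hj k) (hju k)
  have key : ∀ k, ¬ i (m (k + 1)) < i (m k) := by
    intro k hk
    have h0 := hcons k
    have h1 := hcons (k + 1)
    have h2 := hcons (k + 2)
    have a0 := hju k
    have a1 := hju (k + 1)
    have b0 := hMN k
    have b1 := hNN k
    have b2 := hNN (k + 1)
    have c1 := hlen (k + 1)
    have hsmall₁ : i (m (k + 1)) + N (m k) < i (m (k + 1)) + s (m (k + 1)) := by omega
    have hbig₂ : 3 * N (m (k + 1)) ≤ 10 * i (m (k + 2)) := by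
      simp only [add_assoc, Nat.reduceAdd] at *
      omega
    have hsmall₃ : i (m (k + 3)) + N (m (k + 2)) < i (m (k + 3)) + s (m (k + 3)) := by
      have a2 := hju (k + 2)
      have c2 := hlen (k + 2)
      simp only [add_assoc, Nat.reduceAdd] at *
      omega
    exact (hrep (m (k + 1))).false_of_small_starts hlow (hMN k) (hrep (m (k + 3)))
      (hNN k) (hNN (k + 1)) (hNN (k + 2)) (hju k) (hju (k + 1)) (hlen (k + 2)) (hju (k + 2))
      ((hj (k + 1)).trans (hj (k + 2))) hsmall₁ hsmall₃
  have h0 := hcons 0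
  have h1 := hcons 1
  have k0 := key 0
  have k1 := key 1
  have a0 := hju 0
  have a1 := hju 1
  have b0 := hMN 0
  have c1 := hlen 1
  simp only [zero_add, Nat.reduceAdd] at *
  omega

end Combinatorics

/-- The distance of two `b`-adic shifts of `ξ` is controlled by the number of common digits. -/
lemma fract_sub_fract_of_digit_eq {b : ℕ} (hb : 2 ≤ b) (ξ : ℝ) {i j n : ℕ}
    (h : ∀ k < n, digit b ξ (i + k) = digit b ξ (j + k)) :
    (b : ℝ) ^ n * (Int.fract (ξ * b ^ i) - Int.fract (ξ * b ^ j)) =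
      Int.fract (ξ * b ^ (i + n)) - Int.fract (ξ * b ^ (j + n)) := by
  have step : ∀ k, (b : ℝ) * Int.fract (ξ * b ^ k) =
      digit b ξ k + Int.fract (ξ * b ^ (k + 1)) := by
    intro k
    have hdiv : ⌊ξ * (b : ℝ) ^ k⌋ = ⌊ξ * (b : ℝ) ^ (k + 1)⌋ / (b : ℤ) := by
      rw [← Int.floor_div_natCast]
      congr 1
      rw [pow_succ]
      field_simp
    have hdigit : (digit b ξ k : ℤ) = ⌊ξ * (b : ℝ) ^ (k + 1)⌋ % (b : ℤ) :=
      Int.toNat_of_nonneg (Int.emod_nonneg _ (by omega))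
    have hfl : ⌊ξ * (b : ℝ) ^ (k + 1)⌋ = b * ⌊ξ * (b : ℝ) ^ k⌋ + digit b ξ k := by
      rw [hdigit, hdiv, Int.mul_ediv_add_emod]
    have hfl' := congrArg (Int.cast : ℤ → ℝ) hfl
    push_cast at hfl'
    simp only [Int.fract, hfl']
    ring
  induction n with
  | zero => simp
  | succ n ih =>
    rw [pow_succ', mul_assoc, ih fun k hk => h k (by omega), mul_sub, step, step,
      h n (by omega)]
    simp only [add_assoc]
    ring

/-- Repetitions in the digits of an irrational number of irrationality exponent two occur late. -/
lemma eventually_le_minReturn {b : ℕ} (hb : 2 ≤ b) {ξ : ℝ} (hξ : Irrational ξ)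
    (hμ : irrationalityExponent ξ = 2) (hne : ∀ n, (returnSet (digit b ξ) n).Nonempty)
    {ε : ℝ} (hε : 0 < ε) :
    ∀ᶠ n in atTop, (2 - ε) * n ≤ minReturn (digit b ξ) n := by
  by_contra hcon
  have hfreq : ∃ᶠ n : ℕ in atTop, (minReturn (digit b ξ) n : ℝ) < (2 - ε) * n := by
    simpa [Filter.Frequently] using hcon
  have hb1 : (1 : ℝ) < b := by exact_mod_cast hb
  suffices hinf : {pq : ℤ × ℕ | 1 ≤ pq.2 ∧
      |ξ - pq.1 / pq.2| < (pq.2 : ℝ) ^ (-(2 + ε))}.Infinite by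
    have hle : ((2 + ε : ℝ) : EReal) ≤ irrationalityExponent ξ := le_sSup ⟨_, rfl, hinf⟩
    rw [hμ] at hle
    have : 2 + ε ≤ 2 := EReal.coe_le_coe_iff.mp hle
    linarith
  intro hfin
  obtain ⟨δ, hδ, hδle⟩ : ∃ δ > 0, ∀ pq ∈ {pq : ℤ × ℕ | 1 ≤ pq.2 ∧
      |ξ - pq.1 / pq.2| < (pq.2 : ℝ) ^ (-(2 + ε))}, δ ≤ |pq.2 * ξ - pq.1| := by
    have hpos : ∀ pq : ℤ × ℕ, 1 ≤ pq.2 → 0 < |pq.2 * ξ - pq.1| := by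
      intro pq hpq
      have h1 : Irrational (pq.2 * ξ - pq.1) :=
        (hξ.natCast_mul (by omega)).sub_intCast _
      exact abs_pos.mpr h1.ne_zero
    rcases Set.eq_empty_or_nonempty {pq : ℤ × ℕ | 1 ≤ pq.2 ∧
      |ξ - pq.1 / pq.2| < (pq.2 : ℝ) ^ (-(2 + ε))} with he | hn
    · exact ⟨1, one_pos, fun pq hpq => absurd (he ▸ hpq) (Set.notMem_empty pq)⟩
    · obtain ⟨a, ha, hmin⟩ := Set.exists_min_image _
        (fun pq : ℤ × ℕ => |pq.2 * ξ - pq.1|) hfin hn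
      exact ⟨_, hpos a ha.1, hmin⟩
  have hsmall : ∀ᶠ n : ℕ in atTop, ((b : ℝ)⁻¹) ^ n < δ :=
    (tendsto_pow_atTop_nhds_zero_of_lt_one (by positivity) (inv_lt_one_of_one_lt₀ hb1)).eventually
      (gt_mem_nhds hδ)
  obtain ⟨n, hn, hnδ⟩ := (hfreq.and_eventually hsmall).exists
  obtain ⟨i, s, hs, hx, hr⟩ := exists_repeat_of_minReturn (hne n)
  have hfr := fract_sub_fract_of_digit_eq hb ξ (i := i + s) (j := i) (n := n) (fun k hk => by
    rw [hx (i + k) (by omega) (by omega)]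
    congr 1
    omega)
  have hlt : (b : ℝ) ^ n * |Int.fract (ξ * b ^ (i + s)) - Int.fract (ξ * b ^ i)| < 1 := by
    rw [← abs_of_pos (show (0 : ℝ) < b ^ n by positivity), ← abs_mul, hfr, abs_lt]
    have h1 := Int.fract_nonneg (ξ * (b : ℝ) ^ (i + s + n))
    have h2 := Int.fract_lt_one (ξ * (b : ℝ) ^ (i + s + n))
    have h3 := Int.fract_nonneg (ξ * (b : ℝ) ^ (i + n))
    have h4 := Int.fract_lt_one (ξ * (b : ℝ) ^ (i + n))
    constructor <;> linarith
  set q : ℕ := b ^ (i + s) - b ^ i with hq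
  set p : ℤ := ⌊ξ * (b : ℝ) ^ (i + s)⌋ - ⌊ξ * (b : ℝ) ^ i⌋ with hp
  have hpow : b ^ i < b ^ (i + s) := Nat.pow_lt_pow_right (by omega) (by omega)
  have hq1 : 1 ≤ q := by omega
  have hqcast : (q : ℝ) = b ^ (i + s) - b ^ i := by
    rw [hq, Nat.cast_sub hpow.le]
    push_cast
    rfl
  have hqξ : (q : ℝ) * ξ - p = Int.fract (ξ * b ^ (i + s)) - Int.fract (ξ * b ^ i) := by
    rw [hqcast, hp]
    simp only [Int.fract]
    push_cast
    ring
  rw [← hqξ] at hlt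
  have hq0 : (0 : ℝ) < q := by exact_mod_cast hq1
  have hbn : (0 : ℝ) < (b : ℝ) ^ n := by positivity
  have hclose : |(q : ℝ) * ξ - p| < ((b : ℝ)⁻¹) ^ n := by
    rwa [inv_pow, inv_eq_one_div, lt_div_iff₀' hbn]
  refine absurd (hδle (p, q) ⟨hq1, ?_⟩) (not_le.mpr (hclose.trans hnδ))
  have hexp : ((i + s : ℕ) : ℝ) * (1 + ε) ≤ n := by
    rw [hr] at hn
    push_cast at hn ⊢
    nlinarith [mul_nonneg hε.le hε.le, (Nat.cast_nonneg n : (0 : ℝ) ≤ n),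
      mul_nonneg (mul_nonneg hε.le hε.le) (Nat.cast_nonneg n : (0 : ℝ) ≤ n)]
  have hqle : (q : ℝ) ^ (1 + ε) ≤ (b : ℝ) ^ n := by
    calc (q : ℝ) ^ (1 + ε) ≤ ((b : ℝ) ^ (i + s)) ^ (1 + ε) := by
          refine Real.rpow_le_rpow hq0.le ?_ (by linarith)
          rw [hqcast]
          linarith [show (0 : ℝ) < b ^ i by positivity]
      _ = (b : ℝ) ^ (((i + s : ℕ) : ℝ) * (1 + ε)) := by
          rw [Real.rpow_mul (by positivity), Real.rpow_natCast]
      _ ≤ (b : ℝ) ^ (n : ℝ) := Real.rpow_le_rpow_of_exponent_le hb1.le hexp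
      _ = (b : ℝ) ^ n := Real.rpow_natCast _ _
  have hdist : |ξ - p / q| = |(q : ℝ) * ξ - p| / q := by
    rw [← abs_of_pos hq0, ← abs_div, abs_of_pos hq0]
    congr 1
    field_simp
  change |ξ - p / q| < (q : ℝ) ^ (-(2 + ε))
  rw [hdist, show -(2 + ε) = -(1 + ε) + -1 by ring, Real.rpow_add hq0, Real.rpow_neg_one,
    div_eq_mul_inv, Real.rpow_neg hq0.le]
  gcongr
  refine hclose.trans_le ?_
  rw [inv_pow]
  gcongr

theorem stmt13 {b : ℕ} (hb : 2 ≤ b) (ξ : ℝ) (hξ : Irrational ξ)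
    (hμ : irrationalityExponent ξ = (2 : EReal)) :
    ((15 / 7 : ℝ) : EReal) ≤
      limsup (fun n : ℕ => (((minReturn (digit b ξ) n : ℝ) / n : ℝ) : EReal)) atTop := by
  have hfin : (Set.range (digit b ξ)).Finite := by
    refine (Set.finite_Iio b).subset ?_
    rintro _ ⟨k, rfl⟩
    have h1 := Int.emod_lt_of_pos ⌊ξ * (b : ℝ) ^ (k + 1)⌋ (show (0 : ℤ) < b by omega)
    simp only [digit, Set.mem_Iio]
    omega
  have hne := returnSet_nonempty hfin
  by_contra! hlt
  have hup := eventually_lt_of_limsup_lt hlt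
  have hlow := eventually_le_minReturn hb hξ hμ hne (show (0 : ℝ) < 1 / 1000 by norm_num)
  obtain ⟨n₀, hn₀⟩ := eventually_atTop.mp ((hup.and hlow).and (eventually_gt_atTop 0))
  refine false_of_minReturn_bounds (n₀ := n₀) hne (fun n hn => ?_) (fun n hn => ?_)
  · have h1 := (hn₀ n hn).1.2
    have h2 : (1999 : ℝ) * n ≤ 1000 * minReturn (digit b ξ) n := by linarith
    exact_mod_cast h2
  · have h1 := EReal.coe_lt_coe_iff.mp (hn₀ n hn).1.1
    have hn0 : (0 : ℝ) < n := by exact_mod_cast (hn₀ n hn).2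
    rw [div_lt_iff₀ hn0] at h1
    have h2 : (7 : ℝ) * minReturn (digit b ξ) n ≤ 15 * n := by linarith
    exact_mod_cast h2
end
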